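/- arXiv:2305.01391 — 3 statements merged into one kernel-verified Lean document; each statement's English description precedes it below -/
import Mathlib

section
/- The map φ : (c₁,c₂,c₄,c₅) ↦ ((c₁c₅+c₂c₄)/(3c₄), c₅/c₄, c₁/c₄, −3/c₄), defined on the set where all relevant denominators are nonzero, satisfies φ∘φ∘φ∘φ∘φ∘φ = id, i.e. its six-fold composition is the identity wherever defined. -/
/-- The map φ in coordinates (c₁,c₂,c₄,c₅) (indices 0,1,2,3). -/
noncomputable def phiMap (x : Fin 4 → ℝ) : Fin 4 → ℝ :=
  ![(x 0 * x 3 + x 1 * x 2) / (3 * x 2), x 3 / x 2, x 0 / x 2, -3 / x 2]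

lemma phiMap_vec (a b c d : ℝ) :
    phiMap ![a, b, c, d] = ![(a * d + b * c) / (3 * c), d / c, a / c, -3 / c] := by
  simp [phiMap]

lemma vec4_congr {a b c d a₂ b₂ c₂ d₂ : ℝ} (h1 : a = a₂) (h2 : b = b₂) (h3 : c = c₂)
    (h4 : d = d₂) : ![a, b, c, d] = ![a₂, b₂, c₂, d₂] := by
  rw [h1, h2, h3, h4]

/-- the six-fold composition of φ is the identity wherever all
intermediate denominators (the `c₄`-coordinates) are nonzero. -/
theorem stmt6 (x : Fin 4 → ℝ) (hden : ∀ k < 6, (phiMap^[k] x) 2 ≠ 0) :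
    phiMap^[6] x = x := by
  obtain ⟨a, b, c, d, rfl⟩ : ∃ a b c d : ℝ, x = ![a, b, c, d] :=
    ⟨x 0, x 1, x 2, x 3, by ext i; fin_cases i <;> rfl⟩
  obtain ⟨s, hs⟩ : ∃ s, s = a * d + b * c := ⟨_, rfl⟩
  have hc : c ≠ 0 := by simpa using hden 0 (by norm_num)
  have e1 : phiMap^[1] ![a, b, c, d] = ![s / (3 * c), d / c, a / c, -3 / c] := by
    rw [Function.iterate_one, phiMap_vec, hs]
  have ha : a ≠ 0 := by
    have h := hden 1 (by norm_num)
    rw [e1] at h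
    intro h0
    simp [h0] at h
  have e2 : phiMap^[2] ![a, b, c, d] = ![-b / (3 * a), -3 / a, s / (3 * a), -3 * c / a] := by
    rw [Function.iterate_succ_apply', e1, phiMap_vec]
    apply vec4_congr <;> field_simp
    rw [hs]; ring
  have hs0 : s ≠ 0 := by
    have h := hden 2 (by norm_num)
    rw [e2] at h
    intro h0
    simp [h0] at h
  have e3 : phiMap^[3] ![a, b, c, d] = ![-d / s, -9 * c / s, -b / s, -9 * a / s] := by
    rw [Function.iterate_succ_apply', e2, phiMap_vec]
    apply vec4_congr <;> field_simp
    all_goals first | (rw [hs]; ring) | ring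
  have hb : b ≠ 0 := by
    have h := hden 3 (by norm_num)
    rw [e3] at h
    intro h0
    simp [h0] at h
  have e4 : phiMap^[4] ![a, b, c, d] = ![-3 / b, 9 * a / b, d / b, 3 * s / b] := by
    rw [Function.iterate_succ_apply', e3, phiMap_vec]
    apply vec4_congr <;> field_simp
    all_goals first | (rw [hs]; ring) | ring
  have hd : d ≠ 0 := by
    have h := hden 4 (by norm_num)
    rw [e4] at h
    intro h0
    simp [h0] at h
  have e5 : phiMap^[5] ![a, b, c, d] = ![-3 * c / d, 3 * s / d, -3 / d, -3 * b / d] := by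
    rw [Function.iterate_succ_apply', e4, phiMap_vec]
    apply vec4_congr <;> field_simp
    all_goals first | (rw [hs]; ring) | ring
  rw [Function.iterate_succ_apply', e5, phiMap_vec]
  apply vec4_congr <;> field_simp
  all_goals first | (rw [hs]; ring) | ring
end

section
/- For the rolling distribution spanned by V¹ = ∂_θ + cosψ ∂_x + sinψ((1/h)∂_q − (h_x/h)∂_ψ) and V² = ∂_φ − sinψ ∂_x + cosψ((1/h)∂_q − (h_x/h)∂_ψ), the five vector fields V¹, V², [V¹,V²], [V¹,[V¹,V²]], [V²,[V¹,V²]] are pointwise linearly independent (span the full tangent space ℝ⁵) at every point where h(x) ≠ 0, h'(x) ≠ 0 and h''(x) ≠ 0. -/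
/-- Lie bracket of vector fields on ℝⁿ. -/
noncomputable def vfBracket {n : ℕ} (X Y : (Fin n → ℝ) → (Fin n → ℝ)) :
    (Fin n → ℝ) → (Fin n → ℝ) :=
  fun x => fderiv ℝ Y x (X x) - fderiv ℝ X x (Y x)

section
variable (h : ℝ → ℝ)

/-- V¹ on ℝ⁵, coordinates (θ,φ,x,q,ψ) = (0,1,2,3,4). -/
noncomputable def V1 (p : Fin 5 → ℝ) : Fin 5 → ℝ :=
  ![1, 0, Real.cos (p 4), Real.sin (p 4) / h (p 2),
    -Real.sin (p 4) * (deriv h (p 2) / h (p 2))]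

/-- V² on ℝ⁵. -/
noncomputable def V2 (p : Fin 5 → ℝ) : Fin 5 → ℝ :=
  ![0, 1, -Real.sin (p 4), Real.cos (p 4) / h (p 2),
    -Real.cos (p 4) * (deriv h (p 2) / h (p 2))]

end

lemma aux_comp (a b : ℝ → ℝ) (a' b' : ℝ) (p : Fin 5 → ℝ)
    (ha : HasDerivAt a a' (p 4)) (hb : HasDerivAt b b' (p 2)) :
    HasFDerivAt (fun p : Fin 5 → ℝ => a (p 4) * b (p 2))
      ((a' * b (p 2)) • (ContinuousLinearMap.proj 4 : (Fin 5 → ℝ) →L[ℝ] ℝ) +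
        (a (p 4) * b') • (ContinuousLinearMap.proj 2 : (Fin 5 → ℝ) →L[ℝ] ℝ)) p := by
  have h4 : HasFDerivAt (fun p : Fin 5 → ℝ => p 4)
      (ContinuousLinearMap.proj 4 : (Fin 5 → ℝ) →L[ℝ] ℝ) p :=
    (ContinuousLinearMap.proj 4 : (Fin 5 → ℝ) →L[ℝ] ℝ).hasFDerivAt
  have h2 : HasFDerivAt (fun p : Fin 5 → ℝ => p 2)
      (ContinuousLinearMap.proj 2 : (Fin 5 → ℝ) →L[ℝ] ℝ) p :=
    (ContinuousLinearMap.proj 2 : (Fin 5 → ℝ) →L[ℝ] ℝ).hasFDerivAt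
  have A := ha.comp_hasFDerivAt p h4
  have B := hb.comp_hasFDerivAt p h2
  refine (A.mul B).congr_fderiv ?_
  ext v
  simp
  ring

/-- derivative of a field all of whose components are products. -/
lemma aux_fderiv (F : (Fin 5 → ℝ) → (Fin 5 → ℝ)) (a b : Fin 5 → ℝ → ℝ) (a' b' : Fin 5 → ℝ)
    (p v : Fin 5 → ℝ) (hF : ∀ p i, F p i = a i (p 4) * b i (p 2))
    (ha : ∀ i, HasDerivAt (a i) (a' i) (p 4)) (hb : ∀ i, HasDerivAt (b i) (b' i) (p 2)) :
    fderiv ℝ F p v = fun i => a' i * b i (p 2) * v 4 + a i (p 4) * b' i * v 2 := by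
  have hE : F = fun p i => a i (p 4) * b i (p 2) := by
    funext p i; exact hF p i
  have := hasFDerivAt_pi.2 (fun i => aux_comp (a i) (b i) (a' i) (b' i) p (ha i) (hb i))
  rw [hE, this.fderiv]
  ext i
  simp

lemma aux_d0 (h : ℝ → ℝ) (hsmooth : ContDiff ℝ (⊤ : ℕ∞) h) (x : ℝ) : HasDerivAt h (deriv h x) x :=
  (hsmooth.differentiable (by simp) x).hasDerivAt

lemma aux_s1 (h : ℝ → ℝ) (hsmooth : ContDiff ℝ (⊤ : ℕ∞) h) : ContDiff ℝ (⊤ : ℕ∞) (deriv h) :=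
  (contDiff_infty_iff_deriv.1 hsmooth).2

lemma aux_u (h : ℝ → ℝ) (hsmooth : ContDiff ℝ (⊤ : ℕ∞) h) (x : ℝ) (hx : h x ≠ 0) :
    HasDerivAt (fun x => (h x)⁻¹) (-deriv h x / h x ^ 2) x :=
  (aux_d0 h hsmooth x).inv hx

lemma aux_w (h : ℝ → ℝ) (hsmooth : ContDiff ℝ (⊤ : ℕ∞) h) (x : ℝ) (hx : h x ≠ 0) :
    HasDerivAt (fun x => deriv h x / h x)
      ((deriv (deriv h) x * h x - deriv h x * deriv h x) / h x ^ 2) x :=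
  (aux_d0 _ (aux_s1 h hsmooth) x).div (aux_d0 h hsmooth x) hx

lemma aux_V1 (h : ℝ → ℝ) (hsmooth : ContDiff ℝ (⊤ : ℕ∞) h) (p v : Fin 5 → ℝ) (hx : h (p 2) ≠ 0) :
    fderiv ℝ (V1 h) p v = ![0, 0, -Real.sin (p 4) * v 4,
      Real.cos (p 4) * (h (p 2))⁻¹ * v 4 + Real.sin (p 4) * (-deriv h (p 2) / h (p 2) ^ 2) * v 2,
      -Real.cos (p 4) * (deriv h (p 2) / h (p 2)) * v 4 + -Real.sin (p 4) *
        ((deriv (deriv h) (p 2) * h (p 2) - deriv h (p 2) * deriv h (p 2)) / h (p 2) ^ 2)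
        * v 2] := by
  rw [aux_fderiv (V1 h)
    ![fun _ => 1, fun _ => 0, Real.cos, Real.sin, fun x => -Real.sin x]
    ![fun _ => 1, fun _ => 1, fun _ => 1, fun x => (h x)⁻¹, fun x => deriv h x / h x]
    ![0, 0, -Real.sin (p 4), Real.cos (p 4), -Real.cos (p 4)]
    ![0, 0, 0, -deriv h (p 2) / h (p 2) ^ 2,
      (deriv (deriv h) (p 2) * h (p 2) - deriv h (p 2) * deriv h (p 2)) / h (p 2) ^ 2] p v]
  · ext i; fin_cases i <;> simp
  · intro p i; fin_cases i <;> simp [V1, div_eq_mul_inv]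
  · intro i
    fin_cases i
    · exact hasDerivAt_const _ _
    · exact hasDerivAt_const _ _
    · exact Real.hasDerivAt_cos _
    · exact Real.hasDerivAt_sin _
    · exact (Real.hasDerivAt_sin _).neg
  · intro i
    fin_cases i
    · exact hasDerivAt_const _ _
    · exact hasDerivAt_const _ _
    · exact hasDerivAt_const _ _
    · exact aux_u h hsmooth _ hx
    · exact aux_w h hsmooth _ hx

lemma aux_V2 (h : ℝ → ℝ) (hsmooth : ContDiff ℝ (⊤ : ℕ∞) h) (p v : Fin 5 → ℝ) (hx : h (p 2) ≠ 0) :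
    fderiv ℝ (V2 h) p v = ![0, 0, -Real.cos (p 4) * v 4,
      -Real.sin (p 4) * (h (p 2))⁻¹ * v 4 + Real.cos (p 4) * (-deriv h (p 2) / h (p 2) ^ 2) * v 2,
      Real.sin (p 4) * (deriv h (p 2) / h (p 2)) * v 4 + -Real.cos (p 4) *
        ((deriv (deriv h) (p 2) * h (p 2) - deriv h (p 2) * deriv h (p 2)) / h (p 2) ^ 2)
        * v 2] := by
  rw [aux_fderiv (V2 h)
    ![fun _ => 0, fun _ => 1, fun x => -Real.sin x, Real.cos, fun x => -Real.cos x]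
    ![fun _ => 1, fun _ => 1, fun _ => 1, fun x => (h x)⁻¹, fun x => deriv h x / h x]
    ![0, 0, -Real.cos (p 4), -Real.sin (p 4), - -Real.sin (p 4)]
    ![0, 0, 0, -deriv h (p 2) / h (p 2) ^ 2,
      (deriv (deriv h) (p 2) * h (p 2) - deriv h (p 2) * deriv h (p 2)) / h (p 2) ^ 2] p v]
  · ext i; fin_cases i <;> simp
  · intro p i; fin_cases i <;> simp [V2, div_eq_mul_inv]
  · intro i
    fin_cases i
    · exact hasDerivAt_const _ _
    · exact hasDerivAt_const _ _
    · exact (Real.hasDerivAt_sin _).neg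
    · exact Real.hasDerivAt_cos _
    · exact (Real.hasDerivAt_cos _).neg
  · intro i
    fin_cases i
    · exact hasDerivAt_const _ _
    · exact hasDerivAt_const _ _
    · exact hasDerivAt_const _ _
    · exact aux_u h hsmooth _ hx
    · exact aux_w h hsmooth _ hx

/-- The first bracket is vertical. -/
lemma aux_V12 (h : ℝ → ℝ) (hsmooth : ContDiff ℝ (⊤ : ℕ∞) h) (p : Fin 5 → ℝ) (hx : h (p 2) ≠ 0) :
    vfBracket (V1 h) (V2 h) p = ![0, 0, 0, 0, -(deriv (deriv h) (p 2) / h (p 2))] := by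
  have hsc := Real.sin_sq_add_cos_sq (p 4)
  unfold vfBracket
  rw [aux_V1 h hsmooth p _ hx, aux_V2 h hsmooth p _ hx]
  ext i
  fin_cases i
  · simp
  · simp
  · simp [V1, V2]; ring
  · simp [V1, V2]; field_simp; ring
  · simp [V1, V2]; field_simp
    linear_combination (-deriv (deriv h) (p 2) * h (p 2)) * hsc

lemma aux_dV12 (h : ℝ → ℝ) (hsmooth : ContDiff ℝ (⊤ : ℕ∞) h) (p v : Fin 5 → ℝ) (hx : h (p 2) ≠ 0) :
    ∃ k' : ℝ, ∀ v, fderiv ℝ (vfBracket (V1 h) (V2 h)) p v = ![0, 0, 0, 0, k' * v 2] := by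
  have hev : vfBracket (V1 h) (V2 h) =ᶠ[nhds p]
      fun p => ![0, 0, 0, 0, -(deriv (deriv h) (p 2) / h (p 2))] := by
    have hc : Continuous fun p : Fin 5 → ℝ => h (p 2) :=
      hsmooth.continuous.comp (continuous_apply 2)
    filter_upwards [hc.continuousAt.eventually_ne hx] with q hq
    exact aux_V12 h hsmooth q hq
  have hk : HasDerivAt (fun x => -(deriv (deriv h) x / h x)) _ (p 2) :=
    ((aux_d0 _ (aux_s1 _ (aux_s1 h hsmooth)) (p 2)).div (aux_d0 h hsmooth (p 2)) hx).neg
  obtain ⟨k', hk⟩ : ∃ k', HasDerivAt (fun x => -(deriv (deriv h) x / h x)) k' (p 2) := ⟨_, hk⟩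
  refine ⟨k', fun v => ?_⟩
  · rw [hev.fderiv_eq]
    rw [aux_fderiv _ ![fun _ => 0, fun _ => 0, fun _ => 0, fun _ => 0, fun _ => 1]
      ![fun _ => 1, fun _ => 1, fun _ => 1, fun _ => 1, fun x => -(deriv (deriv h) x / h x)]
      ![0, 0, 0, 0, 0] ![0, 0, 0, 0, k'] p v]
    · ext i; fin_cases i <;> simp
    · intro p i; fin_cases i <;> simp
    · intro i
      fin_cases i <;> exact hasDerivAt_const _ _
    · intro i
      fin_cases i
      · exact hasDerivAt_const _ _
      · exact hasDerivAt_const _ _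
      · exact hasDerivAt_const _ _
      · exact hasDerivAt_const _ _
      · exact hk

/-- at every point with `h ≠ 0`, `h' ≠ 0`, `h'' ≠ 0`, the five
vector fields V¹, V², [V¹,V²], [V¹,[V¹,V²]], [V²,[V¹,V²]] are linearly
independent (span the tangent space ℝ⁵). -/
theorem stmt15 (h : ℝ → ℝ) (hsmooth : ContDiff ℝ (⊤ : ℕ∞) h) (p : Fin 5 → ℝ)
    (hh : h (p 2) ≠ 0) (hh1 : deriv h (p 2) ≠ 0)
    (hh2 : deriv (deriv h) (p 2) ≠ 0) :
    LinearIndependent ℝ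
      ![V1 h p, V2 h p, vfBracket (V1 h) (V2 h) p,
        vfBracket (V1 h) (vfBracket (V1 h) (V2 h)) p,
        vfBracket (V2 h) (vfBracket (V1 h) (V2 h)) p] := by
  have hsc := Real.sin_sq_add_cos_sq (p 4)
  obtain ⟨k', hk'⟩ := aux_dV12 h hsmooth p 0 hh
  have e1 : vfBracket (V1 h) (vfBracket (V1 h) (V2 h)) p =
      fderiv ℝ (vfBracket (V1 h) (V2 h)) p (V1 h p) -
        fderiv ℝ (V1 h) p (vfBracket (V1 h) (V2 h) p) := rfl
  have e2 : vfBracket (V2 h) (vfBracket (V1 h) (V2 h)) p =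
      fderiv ℝ (vfBracket (V1 h) (V2 h)) p (V2 h p) -
        fderiv ℝ (V2 h) p (vfBracket (V1 h) (V2 h) p) := rfl
  rw [e1, e2, hk', hk', aux_V12 h hsmooth p hh, aux_V1 h hsmooth p _ hh, aux_V2 h hsmooth p _ hh]
  rw [Fintype.linearIndependent_iff]
  intro g hg
  have c0 := congrFun hg 0
  have c1 := congrFun hg 1
  have c2 := congrFun hg 2
  have c3 := congrFun hg 3
  have c4 := congrFun hg 4
  simp [Fin.sum_univ_five, V1] at c0
  simp [Fin.sum_univ_five, V1, V2] at c0 c1 c2 c3 c4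
  simp only [c0, c1] at c2 c3 c4
  generalize Real.sin (p 4) = s at *
  generalize Real.cos (p 4) = c at *
  generalize deriv (deriv h) (p 2) = d2 at *
  generalize deriv h (p 2) = d1 at *
  generalize h (p 2) = d0 at *
  have hk : d2 / d0 ≠ 0 := div_ne_zero hh2 hh
  have c2' : g 3 * s + g 4 * c = 0 := by
    apply (mul_eq_zero.1 (_ : d2 / d0 * _ = 0)).resolve_left hk
    linear_combination -c2
  have c3' : g 3 * c - g 4 * s = 0 := by
    apply (mul_eq_zero.1 (_ : d2 / d0 * d0⁻¹ * _ = 0)).resolve_left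
      (mul_ne_zero hk (inv_ne_zero hh))
    linear_combination c3
  have h3 : g 3 = 0 := by linear_combination s * c2' + c * c3' - g 3 * hsc
  have h4 : g 4 = 0 := by linear_combination c * c2' - s * c3' - g 4 * hsc
  have h2 : g 2 = 0 := by
    simp [h3, h4] at c4
    tauto
  intro i
  fin_cases i <;> assumption
end

section
/- With Z¹, Z², Z³, S¹, S², S³ as defined (Z¹ = ∂_{c₃} + 2c₅∂_{c₂} − 2c₄∂_{c₁}, Z² = ∂_{c₄} + 4c₃∂_{c₁} − 2c₅∂_{c₃}, Z³ = ∂_{c₅} + 2c₄∂_{c₃} − 4c₃∂_{c₂}, S¹ = Z² + c₅Z¹, S² = Z³ − c₄Z¹, S³ = −c₁Z² + c₂Z³ − (c₁c₅+c₂c₄+c₃²)Z¹) on ℝ⁵, set S⁴ = [S¹,S²], S⁵ = [S²,S³], S⁶ = [S³,S¹], L¹=[S¹,S⁴], L²=[S²,S⁴], L³=[S²,S⁵], L⁴=[S³,S⁵], L⁵=[S³,S⁶], L⁶=[S¹,S⁶], H₁=[S²,S⁶], H₂=[S⁴,S³]. Then the 14 vector fields S¹,…,S⁶, L¹,…,L⁶,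 H₁, H₂ are closed under the Lie bracket (the bracket of any two is a real linear combination of the 14) and span a 14-dimensional Lie algebra. -/
/-- Coordinates (c₁,…,c₅) = indices (0,…,4) on ℝ⁵. -/
noncomputable def Z1 (x : Fin 5 → ℝ) : Fin 5 → ℝ := ![-2 * x 3, 2 * x 4, 1, 0, 0]
noncomputable def Z2 (x : Fin 5 → ℝ) : Fin 5 → ℝ := ![4 * x 2, 0, -2 * x 4, 1, 0]
noncomputable def Z3 (x : Fin 5 → ℝ) : Fin 5 → ℝ := ![0, -4 * x 2, 2 * x 3, 0, 1]

noncomputable def S1 (x : Fin 5 → ℝ) : Fin 5 → ℝ := Z2 x + x 4 • Z1 x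
noncomputable def S2 (x : Fin 5 → ℝ) : Fin 5 → ℝ := Z3 x - x 3 • Z1 x
noncomputable def S3 (x : Fin 5 → ℝ) : Fin 5 → ℝ :=
  -(x 0) • Z2 x + x 1 • Z3 x - (x 0 * x 4 + x 1 * x 3 + (x 2) ^ 2) • Z1 x

noncomputable def S4 := vfBracket S1 S2
noncomputable def S5 := vfBracket S2 S3
noncomputable def S6 := vfBracket S3 S1
noncomputable def L1 := vfBracket S1 S4
noncomputable def L2 := vfBracket S2 S4
noncomputable def L3 := vfBracket S2 S5
noncomputable def L4 := vfBracket S3 S5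
noncomputable def L5 := vfBracket S3 S6
noncomputable def L6 := vfBracket S1 S6
noncomputable def Hf1 := vfBracket S2 S6
noncomputable def Hf2 := vfBracket S4 S3

/-- The 14 vector fields S¹,…,S⁶, L¹,…,L⁶, H₁, H₂. -/
noncomputable def g2Fields : Fin 14 → (Fin 5 → ℝ) → (Fin 5 → ℝ)
  | 0 => S1 | 1 => S2 | 2 => S3 | 3 => S4 | 4 => S5 | 5 => S6
  | 6 => L1 | 7 => L2 | 8 => L3 | 9 => L4 | 10 => L5 | 11 => L6
  | 12 => Hf1 | 13 => Hf2


set_option linter.all false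
set_option linter.unusedSimpArgs false

lemma vfBracket_eq_lie (X Y : (Fin 5 → ℝ) → (Fin 5 → ℝ)) :
    vfBracket X Y = VectorField.lieBracket ℝ X Y := rfl

/-- Differentiability of a vector field given by polynomial components. -/
lemma diff_vec {f0 f1 f2 f3 f4 : (Fin 5 → ℝ) → ℝ} (h0 : ContDiff ℝ ⊤ f0) (h1 : ContDiff ℝ ⊤ f1)
    (h2 : ContDiff ℝ ⊤ f2) (h3 : ContDiff ℝ ⊤ f3) (h4 : ContDiff ℝ ⊤ f4) :
    ContDiff ℝ ⊤ (fun x => ![f0 x, f1 x, f2 x, f3 x, f4 x]) := by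
  rw [contDiff_pi]
  intro i
  fin_cases i
  exacts [h0, h1, h2, h3, h4]

lemma fderiv_coord (k : Fin 5) (x v : Fin 5 → ℝ) :
    fderiv ℝ (fun y : Fin 5 → ℝ => y k) x v = v k := by
  rw [show (fun y : Fin 5 → ℝ => y k) = (ContinuousLinearMap.proj (R := ℝ) k :
    (Fin 5 → ℝ) →L[ℝ] ℝ) from rfl, ContinuousLinearMap.fderiv]
  rfl

lemma br_apply {X Y : (Fin 5 → ℝ) → (Fin 5 → ℝ)} (hX : ContDiff ℝ ⊤ X) (hY : ContDiff ℝ ⊤ Y)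
    (x : Fin 5 → ℝ) (i : Fin 5) :
    vfBracket X Y x i = fderiv ℝ (fun y => Y y i) x (X x) - fderiv ℝ (fun y => X y i) x (Y x) := by
  have key : ∀ {Z : (Fin 5 → ℝ) → (Fin 5 → ℝ)}, ContDiff ℝ ⊤ Z → ∀ v,
      fderiv ℝ Z x v i = fderiv ℝ (fun y => Z y i) x v := by
    intro Z hZ v
    have h : DifferentiableAt ℝ Z x := (hZ.differentiable (by simp)) x
    rw [fderiv_apply h]
    rfl
  simp only [vfBracket, Pi.sub_apply, key hX, key hY]

lemma S1_eq : S1 = fun x =>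
    ![4 * x 2 - 2 * x 3 * x 4,
      2 * x 4 ^ 2,
      -x 4,
      1,
      0] := by
  funext x
  ext i
  fin_cases i <;> simp [S1, Z1, Z2, Z3] <;> ring

lemma S1_smooth : ContDiff ℝ ⊤ S1 := by
  rw [S1_eq]
  apply diff_vec <;> fun_prop

lemma S2_eq : S2 = fun x =>
    ![2 * x 3 ^ 2,
      -4 * x 2 - 2 * x 3 * x 4,
      x 3,
      0,
      1] := by
  funext x
  ext i
  fin_cases i <;> simp [S2, Z1, Z2, Z3] <;> ring

lemma S2_smooth : ContDiff ℝ ⊤ S2 := by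
  rw [S2_eq]
  apply diff_vec <;> fun_prop

lemma S3_eq : S3 = fun x =>
    ![-4 * x 0 * x 2 + 2 * x 0 * x 3 * x 4 + 2 * x 1 * x 3 ^ 2 + 2 * x 2 ^ 2 * x 3,
      -2 * x 0 * x 4 ^ 2 - 4 * x 1 * x 2 - 2 * x 1 * x 3 * x 4 - 2 * x 2 ^ 2 * x 4,
      x 0 * x 4 + x 1 * x 3 - x 2 ^ 2,
      -x 0,
      x 1] := by
  funext x
  ext i
  fin_cases i <;> simp [S3, Z1, Z2, Z3] <;> ring

lemma S3_smooth : ContDiff ℝ ⊤ S3 := by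
  rw [S3_eq]
  apply diff_vec <;> fun_prop

lemma S4_eq : S4 = fun x =>
    ![2 * x 3,
      -2 * x 4,
      2,
      0,
      0] := by
  funext x
  ext i
  rw [S4, br_apply S1_smooth S2_smooth, S1_eq, S2_eq]
  fin_cases i <;> simp (disch := fun_prop) [fderiv_coord, fderiv_fun_mul, fderiv_fun_pow,
    fderiv_fun_add, fderiv_fun_sub] <;> ring

lemma S4_smooth : ContDiff ℝ ⊤ S4 := by
  rw [S4_eq]
  apply diff_vec <;> fun_prop

lemma S5_eq : S5 = fun x =>
    ![2 * x 0 * x 3 - 12 * x 2 * x 3 ^ 2,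
      -2 * x 0 * x 4 + 10 * x 2 ^ 2 + 12 * x 2 * x 3 * x 4,
      2 * x 0 - 6 * x 2 * x 3,
      -2 * x 3 ^ 2,
      -4 * x 2 - 2 * x 3 * x 4] := by
  funext x
  ext i
  rw [S5, br_apply S2_smooth S3_smooth, S2_eq, S3_eq]
  fin_cases i <;> simp (disch := fun_prop) [fderiv_coord, fderiv_fun_mul, fderiv_fun_pow,
    fderiv_fun_add, fderiv_fun_sub] <;> ring

lemma S5_smooth : ContDiff ℝ ⊤ S5 := by
  rw [S5_eq]
  apply diff_vec <;> fun_prop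

lemma S6_eq : S6 = fun x =>
    ![-2 * x 1 * x 3 + 10 * x 2 ^ 2 - 12 * x 2 * x 3 * x 4,
      2 * x 1 * x 4 + 12 * x 2 * x 4 ^ 2,
      -2 * x 1 - 6 * x 2 * x 4,
      4 * x 2 - 2 * x 3 * x 4,
      -2 * x 4 ^ 2] := by
  funext x
  ext i
  rw [S6, br_apply S3_smooth S1_smooth, S3_eq, S1_eq]
  fin_cases i <;> simp (disch := fun_prop) [fderiv_coord, fderiv_fun_mul, fderiv_fun_pow,
    fderiv_fun_add, fderiv_fun_sub] <;> ring

lemma S6_smooth : ContDiff ℝ ⊤ S6 := by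
  rw [S6_eq]
  apply diff_vec <;> fun_prop

lemma L1_eq : L1 = fun x =>
    ![-6,
      0,
      0,
      0,
      0] := by
  funext x
  ext i
  rw [L1, br_apply S1_smooth S4_smooth, S1_eq, S4_eq]
  fin_cases i <;> simp (disch := fun_prop) [fderiv_coord, fderiv_fun_mul, fderiv_fun_pow,
    fderiv_fun_add, fderiv_fun_sub] <;> ring

lemma L1_smooth : ContDiff ℝ ⊤ L1 := by
  rw [L1_eq]
  apply diff_vec <;> fun_prop

lemma L2_eq : L2 = fun x =>
    ![0,
      6,
      0,
      0,
      0] := by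
  funext x
  ext i
  rw [L2, br_apply S2_smooth S4_smooth, S2_eq, S4_eq]
  fin_cases i <;> simp (disch := fun_prop) [fderiv_coord, fderiv_fun_mul, fderiv_fun_pow,
    fderiv_fun_add, fderiv_fun_sub] <;> ring

lemma L2_smooth : ContDiff ℝ ⊤ L2 := by
  rw [L2_eq]
  apply diff_vec <;> fun_prop

lemma L3_eq : L3 = fun x =>
    ![0,
      6 * x 0,
      0,
      0,
      -6 * x 3] := by
  funext x
  ext i
  rw [L3, br_apply S2_smooth S5_smooth, S2_eq, S5_eq]
  fin_cases i <;> simp (disch := fun_prop) [fderiv_coord, fderiv_fun_mul, fderiv_fun_pow,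
    fderiv_fun_add, fderiv_fun_sub] <;> ring

lemma L3_smooth : ContDiff ℝ ⊤ L3 := by
  rw [L3_eq]
  apply diff_vec <;> fun_prop

lemma L4_eq : L4 = fun x =>
    ![6 * x 0 ^ 2 - 24 * x 2 ^ 2 * x 3 ^ 2,
      6 * x 0 * x 1 + 12 * x 2 ^ 3 + 24 * x 2 ^ 2 * x 3 * x 4,
      6 * x 0 * x 2 - 12 * x 2 ^ 2 * x 3,
      6 * x 0 * x 3 - 12 * x 2 * x 3 ^ 2,
      -6 * x 1 * x 3 - 6 * x 2 ^ 2 - 12 * x 2 * x 3 * x 4] := by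
  funext x
  ext i
  rw [L4, br_apply S3_smooth S5_smooth, S3_eq, S5_eq]
  fin_cases i <;> simp (disch := fun_prop) [fderiv_coord, fderiv_fun_mul, fderiv_fun_pow,
    fderiv_fun_add, fderiv_fun_sub] <;> ring

lemma L4_smooth : ContDiff ℝ ⊤ L4 := by
  rw [L4_eq]
  apply diff_vec <;> fun_prop

lemma L5_eq : L5 = fun x =>
    ![-6 * x 0 * x 1 + 12 * x 2 ^ 3 - 24 * x 2 ^ 2 * x 3 * x 4,
      -6 * x 1 ^ 2 + 24 * x 2 ^ 2 * x 4 ^ 2,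
      -6 * x 1 * x 2 - 12 * x 2 ^ 2 * x 4,
      6 * x 0 * x 4 + 6 * x 2 ^ 2 - 12 * x 2 * x 3 * x 4,
      -6 * x 1 * x 4 - 12 * x 2 * x 4 ^ 2] := by
  funext x
  ext i
  rw [L5, br_apply S3_smooth S6_smooth, S3_eq, S6_eq]
  fin_cases i <;> simp (disch := fun_prop) [fderiv_coord, fderiv_fun_mul, fderiv_fun_pow,
    fderiv_fun_add, fderiv_fun_sub] <;> ring

lemma L5_smooth : ContDiff ℝ ⊤ L5 := by
  rw [L5_eq]
  apply diff_vec <;> fun_prop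

lemma L6_eq : L6 = fun x =>
    ![6 * x 1,
      0,
      0,
      -6 * x 4,
      0] := by
  funext x
  ext i
  rw [L6, br_apply S1_smooth S6_smooth, S1_eq, S6_eq]
  fin_cases i <;> simp (disch := fun_prop) [fderiv_coord, fderiv_fun_mul, fderiv_fun_pow,
    fderiv_fun_add, fderiv_fun_sub] <;> ring

lemma L6_smooth : ContDiff ℝ ⊤ L6 := by
  rw [L6_eq]
  apply diff_vec <;> fun_prop

lemma Hf1_eq : Hf1 = fun x =>
    ![0,
      -6 * x 1,
      -2 * x 2,
      2 * x 3,
      -4 * x 4] := by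
  funext x
  ext i
  rw [Hf1, br_apply S2_smooth S6_smooth, S2_eq, S6_eq]
  fin_cases i <;> simp (disch := fun_prop) [fderiv_coord, fderiv_fun_mul, fderiv_fun_pow,
    fderiv_fun_add, fderiv_fun_sub] <;> ring

lemma Hf1_smooth : ContDiff ℝ ⊤ Hf1 := by
  rw [Hf1_eq]
  apply diff_vec <;> fun_prop

lemma Hf2_eq : Hf2 = fun x =>
    ![-6 * x 0,
      -6 * x 1,
      -4 * x 2,
      -2 * x 3,
      -2 * x 4] := by
  funext x
  ext i
  rw [Hf2, br_apply S4_smooth S3_smooth, S4_eq, S3_eq]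
  fin_cases i <;> simp (disch := fun_prop) [fderiv_coord, fderiv_fun_mul, fderiv_fun_pow,
    fderiv_fun_add, fderiv_fun_sub] <;> ring

lemma Hf2_smooth : ContDiff ℝ ⊤ Hf2 := by
  rw [Hf2_eq]
  apply diff_vec <;> fun_prop

lemma br_S1_S3 : vfBracket S1 S3 = (-1 : ℝ) • S6 := by
  funext x
  ext i
  rw [br_apply S1_smooth S3_smooth, S1_eq, S3_eq, S6_eq]
  fin_cases i <;> simp (disch := fun_prop) [fderiv_coord, fderiv_fun_mul, fderiv_fun_pow,
    fderiv_fun_add, fderiv_fun_sub] <;> ring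

lemma br_S1_S5 : vfBracket S1 S5 = (-1 : ℝ) • Hf1 + (1 : ℝ) • Hf2 := by
  funext x
  ext i
  rw [br_apply S1_smooth S5_smooth, S1_eq, S5_eq, Hf1_eq, Hf2_eq]
  fin_cases i <;> simp (disch := fun_prop) [fderiv_coord, fderiv_fun_mul, fderiv_fun_pow,
    fderiv_fun_add, fderiv_fun_sub] <;> ring

lemma br_S1_L1 : vfBracket S1 L1 = 0 := by
  funext x
  ext i
  rw [br_apply S1_smooth L1_smooth, S1_eq, L1_eq]
  fin_cases i <;> simp (disch := fun_prop) [fderiv_coord, fderiv_fun_mul, fderiv_fun_pow,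
    fderiv_fun_add, fderiv_fun_sub] <;> ring

lemma br_S1_L2 : vfBracket S1 L2 = 0 := by
  funext x
  ext i
  rw [br_apply S1_smooth L2_smooth, S1_eq, L2_eq]
  fin_cases i <;> simp (disch := fun_prop) [fderiv_coord, fderiv_fun_mul, fderiv_fun_pow,
    fderiv_fun_add, fderiv_fun_sub] <;> ring

lemma br_S1_L3 : vfBracket S1 L3 = (-6 : ℝ) • S2 := by
  funext x
  ext i
  rw [br_apply S1_smooth L3_smooth, S1_eq, L3_eq, S2_eq]
  fin_cases i <;> simp (disch := fun_prop) [fderiv_coord, fderiv_fun_mul, fderiv_fun_pow,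
    fderiv_fun_add, fderiv_fun_sub] <;> ring

lemma br_S1_L4 : vfBracket S1 L4 = (-6 : ℝ) • S3 := by
  funext x
  ext i
  rw [br_apply S1_smooth L4_smooth, S1_eq, L4_eq, S3_eq]
  fin_cases i <;> simp (disch := fun_prop) [fderiv_coord, fderiv_fun_mul, fderiv_fun_pow,
    fderiv_fun_add, fderiv_fun_sub] <;> ring

lemma br_S1_L5 : vfBracket S1 L5 = 0 := by
  funext x
  ext i
  rw [br_apply S1_smooth L5_smooth, S1_eq, L5_eq]
  fin_cases i <;> simp (disch := fun_prop) [fderiv_coord, fderiv_fun_mul, fderiv_fun_pow,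
    fderiv_fun_add, fderiv_fun_sub] <;> ring

lemma br_S1_L6 : vfBracket S1 L6 = 0 := by
  funext x
  ext i
  rw [br_apply S1_smooth L6_smooth, S1_eq, L6_eq]
  fin_cases i <;> simp (disch := fun_prop) [fderiv_coord, fderiv_fun_mul, fderiv_fun_pow,
    fderiv_fun_add, fderiv_fun_sub] <;> ring

lemma br_S1_Hf1 : vfBracket S1 Hf1 = (2 : ℝ) • S1 := by
  funext x
  ext i
  rw [br_apply S1_smooth Hf1_smooth, S1_eq, Hf1_eq]
  fin_cases i <;> simp (disch := fun_prop) [fderiv_coord, fderiv_fun_mul, fderiv_fun_pow,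
    fderiv_fun_add, fderiv_fun_sub] <;> ring

lemma br_S1_Hf2 : vfBracket S1 Hf2 = (-2 : ℝ) • S1 := by
  funext x
  ext i
  rw [br_apply S1_smooth Hf2_smooth, S1_eq, Hf2_eq]
  fin_cases i <;> simp (disch := fun_prop) [fderiv_coord, fderiv_fun_mul, fderiv_fun_pow,
    fderiv_fun_add, fderiv_fun_sub] <;> ring

lemma br_S2_S1 : vfBracket S2 S1 = (-1 : ℝ) • S4 := by
  funext x
  ext i
  rw [br_apply S2_smooth S1_smooth, S2_eq, S1_eq, S4_eq]
  fin_cases i <;> simp (disch := fun_prop) [fderiv_coord, fderiv_fun_mul, fderiv_fun_pow,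
    fderiv_fun_add, fderiv_fun_sub] <;> ring

lemma br_S2_L1 : vfBracket S2 L1 = 0 := by
  funext x
  ext i
  rw [br_apply S2_smooth L1_smooth, S2_eq, L1_eq]
  fin_cases i <;> simp (disch := fun_prop) [fderiv_coord, fderiv_fun_mul, fderiv_fun_pow,
    fderiv_fun_add, fderiv_fun_sub] <;> ring

lemma br_S2_L2 : vfBracket S2 L2 = 0 := by
  funext x
  ext i
  rw [br_apply S2_smooth L2_smooth, S2_eq, L2_eq]
  fin_cases i <;> simp (disch := fun_prop) [fderiv_coord, fderiv_fun_mul, fderiv_fun_pow,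
    fderiv_fun_add, fderiv_fun_sub] <;> ring

lemma br_S2_L3 : vfBracket S2 L3 = 0 := by
  funext x
  ext i
  rw [br_apply S2_smooth L3_smooth, S2_eq, L3_eq]
  fin_cases i <;> simp (disch := fun_prop) [fderiv_coord, fderiv_fun_mul, fderiv_fun_pow,
    fderiv_fun_add, fderiv_fun_sub] <;> ring

lemma br_S2_L4 : vfBracket S2 L4 = 0 := by
  funext x
  ext i
  rw [br_apply S2_smooth L4_smooth, S2_eq, L4_eq]
  fin_cases i <;> simp (disch := fun_prop) [fderiv_coord, fderiv_fun_mul, fderiv_fun_pow,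
    fderiv_fun_add, fderiv_fun_sub] <;> ring

lemma br_S2_L5 : vfBracket S2 L5 = (-6 : ℝ) • S3 := by
  funext x
  ext i
  rw [br_apply S2_smooth L5_smooth, S2_eq, L5_eq, S3_eq]
  fin_cases i <;> simp (disch := fun_prop) [fderiv_coord, fderiv_fun_mul, fderiv_fun_pow,
    fderiv_fun_add, fderiv_fun_sub] <;> ring

lemma br_S2_L6 : vfBracket S2 L6 = (-6 : ℝ) • S1 := by
  funext x
  ext i
  rw [br_apply S2_smooth L6_smooth, S2_eq, L6_eq, S1_eq]
  fin_cases i <;> simp (disch := fun_prop) [fderiv_coord, fderiv_fun_mul, fderiv_fun_pow,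
    fderiv_fun_add, fderiv_fun_sub] <;> ring

lemma br_S2_Hf1 : vfBracket S2 Hf1 = (-4 : ℝ) • S2 := by
  funext x
  ext i
  rw [br_apply S2_smooth Hf1_smooth, S2_eq, Hf1_eq]
  fin_cases i <;> simp (disch := fun_prop) [fderiv_coord, fderiv_fun_mul, fderiv_fun_pow,
    fderiv_fun_add, fderiv_fun_sub] <;> ring

lemma br_S2_Hf2 : vfBracket S2 Hf2 = (-2 : ℝ) • S2 := by
  funext x
  ext i
  rw [br_apply S2_smooth Hf2_smooth, S2_eq, Hf2_eq]
  fin_cases i <;> simp (disch := fun_prop) [fderiv_coord, fderiv_fun_mul, fderiv_fun_pow,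
    fderiv_fun_add, fderiv_fun_sub] <;> ring

lemma br_S3_S2 : vfBracket S3 S2 = (-1 : ℝ) • S5 := by
  funext x
  ext i
  rw [br_apply S3_smooth S2_smooth, S3_eq, S2_eq, S5_eq]
  fin_cases i <;> simp (disch := fun_prop) [fderiv_coord, fderiv_fun_mul, fderiv_fun_pow,
    fderiv_fun_add, fderiv_fun_sub] <;> ring

lemma br_S3_S4 : vfBracket S3 S4 = (-1 : ℝ) • Hf2 := by
  funext x
  ext i
  rw [br_apply S3_smooth S4_smooth, S3_eq, S4_eq, Hf2_eq]
  fin_cases i <;> simp (disch := fun_prop) [fderiv_coord, fderiv_fun_mul, fderiv_fun_pow,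
    fderiv_fun_add, fderiv_fun_sub] <;> ring

lemma br_S3_L1 : vfBracket S3 L1 = (-6 : ℝ) • S1 := by
  funext x
  ext i
  rw [br_apply S3_smooth L1_smooth, S3_eq, L1_eq, S1_eq]
  fin_cases i <;> simp (disch := fun_prop) [fderiv_coord, fderiv_fun_mul, fderiv_fun_pow,
    fderiv_fun_add, fderiv_fun_sub] <;> ring

lemma br_S3_L2 : vfBracket S3 L2 = (-6 : ℝ) • S2 := by
  funext x
  ext i
  rw [br_apply S3_smooth L2_smooth, S3_eq, L2_eq, S2_eq]
  fin_cases i <;> simp (disch := fun_prop) [fderiv_coord, fderiv_fun_mul, fderiv_fun_pow,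
    fderiv_fun_add, fderiv_fun_sub] <;> ring

lemma br_S3_L3 : vfBracket S3 L3 = 0 := by
  funext x
  ext i
  rw [br_apply S3_smooth L3_smooth, S3_eq, L3_eq]
  fin_cases i <;> simp (disch := fun_prop) [fderiv_coord, fderiv_fun_mul, fderiv_fun_pow,
    fderiv_fun_add, fderiv_fun_sub] <;> ring

lemma br_S3_L4 : vfBracket S3 L4 = 0 := by
  funext x
  ext i
  rw [br_apply S3_smooth L4_smooth, S3_eq, L4_eq]
  fin_cases i <;> simp (disch := fun_prop) [fderiv_coord, fderiv_fun_mul, fderiv_fun_pow,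
    fderiv_fun_add, fderiv_fun_sub] <;> ring

lemma br_S3_L5 : vfBracket S3 L5 = 0 := by
  funext x
  ext i
  rw [br_apply S3_smooth L5_smooth, S3_eq, L5_eq]
  fin_cases i <;> simp (disch := fun_prop) [fderiv_coord, fderiv_fun_mul, fderiv_fun_pow,
    fderiv_fun_add, fderiv_fun_sub] <;> ring

lemma br_S3_L6 : vfBracket S3 L6 = 0 := by
  funext x
  ext i
  rw [br_apply S3_smooth L6_smooth, S3_eq, L6_eq]
  fin_cases i <;> simp (disch := fun_prop) [fderiv_coord, fderiv_fun_mul, fderiv_fun_pow,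
    fderiv_fun_add, fderiv_fun_sub] <;> ring

lemma br_S3_Hf1 : vfBracket S3 Hf1 = (2 : ℝ) • S3 := by
  funext x
  ext i
  rw [br_apply S3_smooth Hf1_smooth, S3_eq, Hf1_eq]
  fin_cases i <;> simp (disch := fun_prop) [fderiv_coord, fderiv_fun_mul, fderiv_fun_pow,
    fderiv_fun_add, fderiv_fun_sub] <;> ring

lemma br_S3_Hf2 : vfBracket S3 Hf2 = (4 : ℝ) • S3 := by
  funext x
  ext i
  rw [br_apply S3_smooth Hf2_smooth, S3_eq, Hf2_eq]
  fin_cases i <;> simp (disch := fun_prop) [fderiv_coord, fderiv_fun_mul, fderiv_fun_pow,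
    fderiv_fun_add, fderiv_fun_sub] <;> ring

/-- The real span of the fourteen fields. -/
noncomputable def g2Span : Submodule ℝ ((Fin 5 → ℝ) → (Fin 5 → ℝ)) :=
  Submodule.span ℝ (Set.range g2Fields)

lemma field_mem (k : Fin 14) : g2Fields k ∈ g2Span := Submodule.subset_span ⟨k, rfl⟩

lemma field_smooth (k : Fin 14) : ContDiff ℝ ⊤ (g2Fields k) := by
  fin_cases k
  exacts [S1_smooth, S2_smooth, S3_smooth, S4_smooth, S5_smooth, S6_smooth, L1_smooth, L2_smooth, L3_smooth, L4_smooth, L5_smooth, L6_smooth, Hf1_smooth, Hf2_smooth]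

lemma span_smooth {X : (Fin 5 → ℝ) → (Fin 5 → ℝ)} (hX : X ∈ g2Span) : ContDiff ℝ ⊤ X := by
  induction hX using Submodule.span_induction with
  | mem X h => obtain ⟨k, rfl⟩ := h; exact field_smooth k
  | zero => exact contDiff_const
  | add X Y _ _ hX hY => exact hX.add hY
  | smul c X _ hX => exact contDiff_const.smul hX

/-- `X` normalizes the span. -/
def Normalizes (X : (Fin 5 → ℝ) → (Fin 5 → ℝ)) : Prop :=
  ∀ Y ∈ g2Span, vfBracket X Y ∈ g2Span

lemma normalizes_of_fields {X : (Fin 5 → ℝ) → (Fin 5 → ℝ)}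
    (h : ∀ k, vfBracket X (g2Fields k) ∈ g2Span) : Normalizes X := by
  intro Y hY
  induction hY using Submodule.span_induction with
  | mem Y h' => obtain ⟨k, rfl⟩ := h'; exact h k
  | zero =>
    rw [vfBracket_eq_lie, VectorField.lieBracket_zero_right]
    exact g2Span.zero_mem
  | add Y Z hY' hZ' hY hZ =>
    have e : vfBracket X (Y + Z) = vfBracket X Y + vfBracket X Z := by
      funext x
      exact VectorField.lieBracket_add_right ((span_smooth hY').differentiable (by simp) x)
        ((span_smooth hZ').differentiable (by simp) x)
    rw [e]
    exact g2Span.add_mem hY hZ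
  | smul c Y hY' hY =>
    have e : vfBracket X (c • Y) = c • vfBracket X Y := by
      funext x
      exact VectorField.lieBracket_const_smul_right ((span_smooth hY').differentiable (by simp) x)
    rw [e]
    exact g2Span.smul_mem c hY

lemma Normalizes.bracket {X Y : (Fin 5 → ℝ) → (Fin 5 → ℝ)} (hXs : ContDiff ℝ ⊤ X)
    (hYs : ContDiff ℝ ⊤ Y) (hX : Normalizes X) (hY : Normalizes Y) :
    Normalizes (vfBracket X Y) := by
  intro W hW
  have e : vfBracket (vfBracket X Y) W
      = vfBracket X (vfBracket Y W) - vfBracket Y (vfBracket X W) := by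
    funext x
    have := VectorField.leibniz_identity_lieBracket (𝕜 := ℝ) (n := ⊤) (by simp)
      hXs.contDiffAt hYs.contDiffAt ((span_smooth hW).contDiffAt (x := x))
    exact eq_sub_of_add_eq this.symm
  rw [e]
  exact g2Span.sub_mem (hX _ (hY _ hW)) (hY _ (hX _ hW))

lemma vfBracket_self (X : (Fin 5 → ℝ) → (Fin 5 → ℝ)) : vfBracket X X = 0 := by
  funext x
  simp [vfBracket]

lemma norm_S1 : Normalizes S1 := by
  apply normalizes_of_fields
  intro k
  fin_cases k
  · exact vfBracket_self S1 ▸ g2Span.zero_mem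
  · exact field_mem 3
  · exact br_S1_S3 ▸ g2Span.smul_mem _ (field_mem 5)
  · exact field_mem 6
  · exact br_S1_S5 ▸ g2Span.add_mem (g2Span.smul_mem _ (field_mem 12)) (g2Span.smul_mem _ (field_mem 13))
  · exact field_mem 11
  · exact br_S1_L1 ▸ g2Span.zero_mem
  · exact br_S1_L2 ▸ g2Span.zero_mem
  · exact br_S1_L3 ▸ g2Span.smul_mem _ (field_mem 1)
  · exact br_S1_L4 ▸ g2Span.smul_mem _ (field_mem 2)
  · exact br_S1_L5 ▸ g2Span.zero_mem
  · exact br_S1_L6 ▸ g2Span.zero_mem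
  · exact br_S1_Hf1 ▸ g2Span.smul_mem _ (field_mem 0)
  · exact br_S1_Hf2 ▸ g2Span.smul_mem _ (field_mem 0)

lemma norm_S2 : Normalizes S2 := by
  apply normalizes_of_fields
  intro k
  fin_cases k
  · exact br_S2_S1 ▸ g2Span.smul_mem _ (field_mem 3)
  · exact vfBracket_self S2 ▸ g2Span.zero_mem
  · exact field_mem 4
  · exact field_mem 7
  · exact field_mem 8
  · exact field_mem 12
  · exact br_S2_L1 ▸ g2Span.zero_mem
  · exact br_S2_L2 ▸ g2Span.zero_mem
  · exact br_S2_L3 ▸ g2Span.zero_mem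
  · exact br_S2_L4 ▸ g2Span.zero_mem
  · exact br_S2_L5 ▸ g2Span.smul_mem _ (field_mem 2)
  · exact br_S2_L6 ▸ g2Span.smul_mem _ (field_mem 0)
  · exact br_S2_Hf1 ▸ g2Span.smul_mem _ (field_mem 1)
  · exact br_S2_Hf2 ▸ g2Span.smul_mem _ (field_mem 1)

lemma norm_S3 : Normalizes S3 := by
  apply normalizes_of_fields
  intro k
  fin_cases k
  · exact field_mem 5
  · exact br_S3_S2 ▸ g2Span.smul_mem _ (field_mem 4)
  · exact vfBracket_self S3 ▸ g2Span.zero_mem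
  · exact br_S3_S4 ▸ g2Span.smul_mem _ (field_mem 13)
  · exact field_mem 9
  · exact field_mem 10
  · exact br_S3_L1 ▸ g2Span.smul_mem _ (field_mem 0)
  · exact br_S3_L2 ▸ g2Span.smul_mem _ (field_mem 1)
  · exact br_S3_L3 ▸ g2Span.zero_mem
  · exact br_S3_L4 ▸ g2Span.zero_mem
  · exact br_S3_L5 ▸ g2Span.zero_mem
  · exact br_S3_L6 ▸ g2Span.zero_mem
  · exact br_S3_Hf1 ▸ g2Span.smul_mem _ (field_mem 2)
  · exact br_S3_Hf2 ▸ g2Span.smul_mem _ (field_mem 2)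

lemma norm_S4 : Normalizes S4 := norm_S1.bracket S1_smooth S2_smooth norm_S2

lemma norm_S5 : Normalizes S5 := norm_S2.bracket S2_smooth S3_smooth norm_S3

lemma norm_S6 : Normalizes S6 := norm_S3.bracket S3_smooth S1_smooth norm_S1

lemma norm_L1 : Normalizes L1 := norm_S1.bracket S1_smooth S4_smooth norm_S4

lemma norm_L2 : Normalizes L2 := norm_S2.bracket S2_smooth S4_smooth norm_S4

lemma norm_L3 : Normalizes L3 := norm_S2.bracket S2_smooth S5_smooth norm_S5

lemma norm_L4 : Normalizes L4 := norm_S3.bracket S3_smooth S5_smooth norm_S5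

lemma norm_L5 : Normalizes L5 := norm_S3.bracket S3_smooth S6_smooth norm_S6

lemma norm_L6 : Normalizes L6 := norm_S1.bracket S1_smooth S6_smooth norm_S6

lemma norm_Hf1 : Normalizes Hf1 := norm_S2.bracket S2_smooth S6_smooth norm_S6

lemma norm_Hf2 : Normalizes Hf2 := norm_S4.bracket S4_smooth S3_smooth norm_S3

lemma norm_field (k : Fin 14) : Normalizes (g2Fields k) := by
  fin_cases k
  exacts [norm_S1, norm_S2, norm_S3, norm_S4, norm_S5, norm_S6, norm_L1, norm_L2, norm_L3, norm_L4, norm_L5, norm_L6, norm_Hf1, norm_Hf2]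

/-- the 14 vector fields are closed under the Lie bracket and are
linearly independent over ℝ, hence span a 14-dimensional Lie algebra. -/
theorem stmt19 :
    (∀ i j : Fin 14, ∃ a : Fin 14 → ℝ, ∀ x : Fin 5 → ℝ,
        vfBracket (g2Fields i) (g2Fields j) x = ∑ k, a k • g2Fields k x) ∧
    (∀ a : Fin 14 → ℝ,
        (∀ x : Fin 5 → ℝ, ∑ k, a k • g2Fields k x = 0) → a = 0) := by
  refine ⟨fun i j => ?_, fun a h => ?_⟩
  · obtain ⟨a, ha⟩ := (Submodule.mem_span_range_iff_exists_fun ℝ).1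
      (norm_field i _ (field_mem j))
    refine ⟨a, fun x => ?_⟩
    rw [← ha]
    simp
  · have e0 := h ![0, 0, 0, 0, 0]
    have e1 := h ![1, 0, 0, 0, 0]
    have e2 := h ![0, 1, 0, 0, 0]
    have e3 := h ![0, 0, 1, 0, 0]
    simp [Fin.sum_univ_succ, g2Fields, S1_eq, S2_eq, S3_eq, S4_eq, S5_eq, S6_eq, L1_eq, L2_eq, L3_eq, L4_eq, L5_eq, L6_eq, Hf1_eq, Hf2_eq] at e0 e1 e2 e3
    obtain ⟨h6, h7, h3, h0, h1⟩ := e0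
    obtain ⟨f0, f1, f2, f3, -⟩ := e1
    obtain ⟨g0, g1, g2, -, -⟩ := e2
    obtain ⟨-, -, -, k3, k4⟩ := e3
    have h2 : a 2 = 0 := by linarith
    have h4 : a 4 = 0 := by linarith
    have h5 : a 5 = 0 := by linarith
    have h8 : a 8 = 0 := by linarith
    have h9 : a 9 = 0 := by linarith
    have h10 : a 10 = 0 := by linarith
    have h11 : a 11 = 0 := by linarith
    have h13 : a 13 = 0 := by linarith
    have h12 : a 12 = 0 := by linarith
    funext k
    fin_cases k
    exacts [h0, h1, h2, h3, h4, h5, h6, h7, h8, h9, h10, h11, h12, h13]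
end
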